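/- There exists an element g₁ ∈ F₁ such that d₁(g₁) is a regular element of P and P·g₁ is a free direct summand of F₁ of rank one; that is, there is a P-submodule C of F₁ with F₁ = P·g₁ ⊕ C and the map P → P·g₁, a ↦ a·g₁, an isomorphism. -/

import Mathlib

open QuadraticMap LinearMap Submodule Function

/-- Prime avoidance for cosets: if no prime in the finite set `S` contains both `x` and `J`,
then some element of the coset `x + J` avoids every prime in `S`. -/
theorem Ideal.exists_add_notMem_of_finset_isPrime {R : Type*} [CommRing R] (x : R) (J : Ideal R)
    (S : Finset (Ideal R)) (hS : ∀ p ∈ S, p.IsPrime) (hx : ∀ p ∈ S, x ∈ p → ¬ J ≤ p) :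
    ∃ y ∈ J, ∀ p ∈ S, x + y ∉ p := by
  classical
  induction S using Finset.strongInduction with
  | H S ih =>
    rcases S.eq_empty_or_nonempty with rfl | hne
    · exact ⟨0, J.zero_mem, by simp⟩
    obtain ⟨q, hq⟩ := S.exists_minimal hne
    have hqS : q ∈ S := hq.1
    have hqp : q.IsPrime := hS q hqS
    obtain ⟨y, hyJ, hy⟩ := ih (S.erase q) (Finset.erase_ssubset hqS)
      (fun p hp => hS p (Finset.mem_of_mem_erase hp))
      (fun p hp => hx p (Finset.mem_of_mem_erase hp))
    by_cases hyq : x + y ∈ q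
    · have hJq : ¬ J ≤ q := fun h => hx q hqS ((q.add_mem_iff_left (h hyJ)).1 hyq) h
      have hprod : ¬ J * ∏ p ∈ S.erase q, p ≤ q := by
        rw [hqp.mul_le, hqp.prod_le]
        rintro (h | ⟨p, hp, hpq⟩)
        · exact hJq h
        · exact Finset.ne_of_mem_erase hp
            (le_antisymm hpq (hq.2 (Finset.mem_of_mem_erase hp) hpq))
      obtain ⟨z, hz, hzq⟩ := SetLike.not_le_iff_exists.1 hprod
      have hzJ : z ∈ J := (Ideal.mul_le_left : J * ∏ p ∈ S.erase q, p ≤ J) hz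
      have hzS : z ∈ ∏ p ∈ S.erase q, p :=
        (Ideal.mul_le_right : J * ∏ p ∈ S.erase q, p ≤ ∏ p ∈ S.erase q, p) hz
      refine ⟨y + z, J.add_mem hyJ hzJ, fun p hp => ?_⟩
      rw [← add_assoc]
      by_cases hpq : p = q
      · subst hpq
        rwa [p.add_mem_iff_right hyq]
      · have hpe : p ∈ S.erase q := Finset.mem_erase.2 ⟨hpq, hp⟩
        have hinf : ∏ p ∈ S.erase q, p ≤ (S.erase q).inf fun p => p := Ideal.prod_le_inf
        have hzp : z ∈ p := Finset.inf_le (f := fun p : Ideal R => p) hpe (hinf hzS)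
        rw [p.add_mem_iff_left hzp]
        exact hy p hpe
    · refine ⟨y, hyJ, fun p hp => ?_⟩
      by_cases hpq : p = q
      · rwa [hpq]
      · exact hy p (Finset.mem_erase.2 ⟨hpq, hp⟩)

/-- If `φ e = 1` and the range of `d` contains a regular element, then `d g` is regular for
some `g` with `φ g = 1`. -/
theorem LinearMap.exists_mem_nonZeroDivisors_of_apply_eq_one {R M : Type*} [CommRing R]
    [IsNoetherianRing R] [AddCommGroup M] [Module R M] (d φ : M →ₗ[R] R) {e : M} (he : φ e = 1)
    (hd : ∃ v, d v ∈ nonZeroDivisors R) :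
    ∃ g, d g ∈ nonZeroDivisors R ∧ φ g = 1 := by
  obtain ⟨v, hv⟩ := hd
  have hcompl := biUnion_associatedPrimes_eq_compl_nonZeroDivisors R
  have hfin := associatedPrimes.finite R R
  obtain ⟨y, ⟨k, hk, rfl⟩, hy⟩ := Ideal.exists_add_notMem_of_finset_isPrime (d e)
    (Submodule.map d (LinearMap.ker φ)) hfin.toFinset
    (fun p hp => (hfin.mem_toFinset.1 hp).isPrime) (by
      intro p hp hep hle
      have hvp : d v ∈ p := by
        have hker : v - φ v • e ∈ LinearMap.ker φ := by simp [he]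
        have hsub : d (v - φ v • e) ∈ p := hle (Submodule.mem_map_of_mem hker)
        have hsum := p.add_mem hsub (p.mul_mem_left (φ v) hep)
        simpa using hsum
      have hmem : d v ∈ (nonZeroDivisors R : Set R)ᶜ :=
        hcompl ▸ Set.mem_biUnion (hfin.mem_toFinset.1 hp) hvp
      exact hmem hv)
  refine ⟨e + k, ?_, by simpa [he] using hk⟩
  by_contra hg
  have hmem : d (e + k) ∈ (nonZeroDivisors R : Set R)ᶜ := hg
  rw [← hcompl] at hmem
  obtain ⟨p, hp, hgp⟩ := Set.mem_iUnion₂.1 hmem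
  exact hy p (hfin.mem_toFinset.2 hp) (by simpa using hgp)

theorem LinearMap.isCompl_span_singleton_ker_of_apply_eq_one {R M : Type*} [CommRing R]
    [AddCommGroup M] [Module R M] (φ : M →ₗ[R] R) {g : M} (hg : φ g = 1) :
    IsCompl (Submodule.span R {g}) (LinearMap.ker φ) := by
  constructor
  · rw [Submodule.disjoint_def]
    intro x hx hxk
    obtain ⟨a, rfl⟩ := Submodule.mem_span_singleton.1 hx
    have ha : a = 0 := by simpa [hg] using hxk
    simp [ha]
  · rw [codisjoint_iff, eq_top_iff]
    intro x _
    exact Submodule.mem_sup.2 ⟨φ x • g, Submodule.smul_mem _ _ (Submodule.mem_span_singleton_self g),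
      x - φ x • g, by simp [hg], by simp⟩

theorem stmt_7
    (P : Type*) [CommRing P] [IsNoetherianRing P]
    (F1 : Type*) [AddCommGroup F1] [Module P F1] [Module.Free P F1] [Module.Finite P F1]
    (d1 : F1 →ₗ[P] P)
    (hreg : ∃ x1, d1 x1 ∈ nonZeroDivisors P)
    : ∃ (g1 : F1) (C : Submodule P F1),
      d1 g1 ∈ nonZeroDivisors P ∧
      IsCompl (Submodule.span P {g1}) C ∧
      Function.Injective (fun a : P => a • g1) := by
  cases subsingleton_or_nontrivial P with
  | inl _ =>
    have := Module.subsingleton P F1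
    exact ⟨0, ⊤, by rw [Subsingleton.elim (d1 0) 1]; exact one_mem _,
      by simpa using isCompl_bot_top, injective_of_subsingleton _⟩
  | inr _ =>
    let b := Module.Free.chooseBasis P F1
    have hne : Nonempty (Module.Free.ChooseBasisIndex P F1) := by
      by_contra h
      rw [not_nonempty_iff] at h
      have : Subsingleton F1 := b.repr.toEquiv.subsingleton
      obtain ⟨x, hx⟩ := hreg
      rw [Subsingleton.elim x 0, map_zero] at hx
      exact zero_notMem_nonZeroDivisors hx
    obtain ⟨i⟩ := hne
    obtain ⟨g, hg, hφ⟩ := d1.exists_mem_nonZeroDivisors_of_apply_eq_one (b.coord i)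
      (e := b i) (by simp) hreg
    refine ⟨g, LinearMap.ker (b.coord i), hg,
      LinearMap.isCompl_span_singleton_ker_of_apply_eq_one _ hφ, fun a c hac => ?_⟩
    have hφac := congrArg (b.coord i) hac
    simpa only [map_smul, hφ, smul_eq_mul, mul_one] using hφac
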